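/- If A and B are subsets of ℕ with positive upper Banach density, then the difference set A − B = {a − b : a ∈ A, b ∈ B, a ≥ b} is piecewise syndetic (Jin's theorem). -/

import Mathlib

open Filter

/-- The upper Banach density of a set of natural numbers. -/
noncomputable def upperBanachDensity (A : Set ℕ) : ℝ :=
  Filter.limsup (fun N : ℕ =>
    ⨆ M : ℕ, (Nat.card (A ∩ Set.Icc (M + 1) (M + N) : Set ℕ) : ℝ) / N) Filter.atTop

/-- A set of natural numbers is thick if it contains arbitrarily long intervals. -/
def Thick (A : Set ℕ) : Prop :=
  ∀ N : ℕ, ∃ M : ℕ, Set.Icc (M + 1) (M + N) ⊆ A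

/-- A set is syndetic if finitely many of its shifts cover ℕ. -/
def Syndetic (S : Set ℕ) : Prop :=
  ∃ F : Finset ℕ, ∀ m : ℕ, ∃ n ∈ F, m + n ∈ S

/-- A set is piecewise syndetic if it is the intersection of a thick set and a syndetic set. -/
def PiecewiseSyndetic (A : Set ℕ) : Prop :=
  ∃ T S : Set ℕ, Thick T ∧ Syndetic S ∧ A = S ∩ T

/-- A set some finite union of whose shifts is thick is piecewise syndetic. -/
theorem PiecewiseSyndetic.of_shifts {D : Set ℕ} (F : Finset ℕ)
    (h : Thick {m | ∃ n ∈ F, m + n ∈ D}) : PiecewiseSyndetic D := by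
  refine ⟨{m | ∃ n ∈ F, m + n ∈ D} ∪ D, D ∪ {m | ∃ n ∈ F, m + n ∈ D}ᶜ, fun N ↦ ?_,
    ⟨insert 0 F, fun m ↦ ?_⟩, ?_⟩
  · obtain ⟨M, hM⟩ := h N
    exact ⟨M, hM.trans Set.subset_union_left⟩
  · by_cases hm : ∃ n ∈ F, m + n ∈ D
    · obtain ⟨n, hn, hmn⟩ := hm
      exact ⟨n, Finset.mem_insert_of_mem hn, Or.inl hmn⟩
    · exact ⟨0, Finset.mem_insert_self _ _, Or.inr hm⟩
  · ext m
    simp only [Set.mem_inter_iff, Set.mem_union, Set.mem_compl_iff]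
    tauto

/-- A set of positive upper Banach density has density bounded below on arbitrarily long
intervals. -/
theorem exists_dense_intervals {A : Set ℕ} (hA : 0 < upperBanachDensity A) :
    ∃ α : ℝ, 0 < α ∧ ∀ L : ℕ, ∃ N ≥ L, ∃ M : ℕ, ∃ S : Finset ℕ,
      S ⊆ Finset.Ioc M (M + N) ∧ (∀ x ∈ S, x ∈ A) ∧ α * N ≤ S.card := by
  classical
  obtain ⟨α, hα, hαA⟩ := exists_between hA
  refine ⟨α, hα, fun L ↦ ?_⟩
  have hfreq := frequently_lt_of_lt_limsup (isCoboundedUnder_le_of_le atTop (x := 0)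
    fun N : ℕ ↦ Real.iSup_nonneg fun M ↦ by positivity) hαA
  obtain ⟨N, hN, hlt⟩ := frequently_atTop.1 hfreq (L + 1)
  obtain ⟨M, hM⟩ := exists_lt_of_lt_ciSup hlt
  refine ⟨N, by omega, M, (Finset.Ioc M (M + N)).filter (· ∈ A), Finset.filter_subset _ _,
    fun x hx ↦ (Finset.mem_filter.1 hx).2, ?_⟩
  have hN0 : (0 : ℝ) < N := by exact_mod_cast (by omega : 0 < N)
  rw [lt_div_iff₀ hN0] at hM
  have hset : (A ∩ Set.Icc (M + 1) (M + N) : Set ℕ) =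
      ((Finset.Ioc M (M + N)).filter (· ∈ A) : Finset ℕ) := by
    ext x
    simp only [Set.mem_inter_iff, Set.mem_Icc, Finset.coe_filter, Finset.mem_Ioc,
      Set.mem_ofPred_eq, Nat.succ_le_iff]
    tauto
  rw [hset, Nat.card_coe_set_eq, Set.ncard_coe_finset] at hM
  exact hM.le

/-- Two sets of positive upper Banach density contain, up to a large shift, a common dense subset
of some long interval. -/
theorem exists_common_dense_subset {A B : Set ℕ} (hA : 0 < upperBanachDensity A)
    (hB : 0 < upperBanachDensity B) :
    ∃ δ : ℝ, 0 < δ ∧ ∀ L : ℕ, ∃ N ≥ L, ∃ M : ℕ, ∃ t ≥ L, ∃ C : Finset ℕ,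
      C ⊆ Finset.Ioc M (M + N) ∧ (∀ c ∈ C, c ∈ B ∧ c + t ∈ A) ∧ δ * N ≤ C.card := by
  classical
  obtain ⟨α, hα, hA⟩ := exists_dense_intervals hA
  obtain ⟨β, hβ, hB⟩ := exists_dense_intervals hB
  refine ⟨α * β / 4, by positivity, fun L ↦ ?_⟩
  obtain ⟨N, hN, M, S, hS, hSB, hScard⟩ := hB L
  set K := M + N + L with hK
  obtain ⟨N', hN', M', T, hT, hTA, hTcard⟩ := hA (max (N + 1) ⌈2 * K / α⌉₊)
  have hKN' : (2 * K / α : ℝ) ≤ N' :=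
    (Nat.le_ceil _).trans (by exact_mod_cast (le_max_right _ _).trans hN')
  have hNN' : N + 1 ≤ N' := (le_max_left _ _).trans hN'
  rw [div_le_iff₀ hα] at hKN'
  set T' := T \ Finset.range K with hT'
  have hT'card : α / 2 * N' ≤ T'.card := by
    have h1 : T.card ≤ T'.card + K := by
      have := Finset.le_card_sdiff (Finset.range K) T
      rw [Finset.card_range, ← hT'] at this
      omega
    have h2 : (T.card : ℝ) ≤ T'.card + K := by exact_mod_cast h1
    linarith
  have hT'mem : ∀ x ∈ T', x ∈ A ∧ K ≤ x ∧ M' < x ∧ x ≤ M' + N' := by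
    intro x hx
    rw [hT', Finset.mem_sdiff, Finset.mem_range] at hx
    have := Finset.mem_Ioc.1 (hT hx.1)
    exact ⟨hTA x hx.1, by omega, this.1, this.2⟩
  have hSmem : ∀ y ∈ S, M < y ∧ y ≤ M + N := fun y hy ↦ Finset.mem_Ioc.1 (hS hy)
  set Q := Finset.Ico (M' + 1 - (M + N)) (M' + N' - M) with hQ
  have hQcard : (Q.card : ℝ) ≤ 2 * N' := by
    have : Q.card ≤ 2 * N' := by rw [hQ, Nat.card_Ico]; omega
    exact_mod_cast this
  have hmaps : ∀ p ∈ T' ×ˢ S, p.1 - p.2 ∈ Q := by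
    rintro ⟨x, y⟩ hp
    obtain ⟨hx, hy⟩ := Finset.mem_product.1 hp
    have h1 := hT'mem x hx
    have h2 := hSmem y hy
    rw [hQ, Finset.mem_Ico]
    dsimp only at h1 h2 ⊢
    omega
  by_cases hN0 : N = 0
  · subst hN0
    exact ⟨0, hN, M, L, le_rfl, ∅, by simp, by simp, by simp⟩
  have hN0' : (0 : ℝ) < N := by exact_mod_cast Nat.pos_of_ne_zero hN0
  have hN'0 : (0 : ℝ) < N' := by exact_mod_cast (by omega : 0 < N')
  have hprod : (α / 2 * N') * (β * N) ≤ ((T' ×ˢ S).card : ℝ) := by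
    rw [Finset.card_product]
    push_cast
    gcongr
  have hQne : Q.Nonempty := by
    have : 0 < (T' ×ˢ S).card := by
      have : (0 : ℝ) < (T' ×ˢ S).card := lt_of_lt_of_le (by positivity) hprod
      exact_mod_cast this
    obtain ⟨p, hp⟩ := Finset.card_pos.1 this
    exact ⟨_, hmaps p hp⟩
  obtain ⟨t, -, ht⟩ := Finset.exists_le_card_fiber_of_nsmul_le_card_of_maps_to
    (b := α * β / 4 * N) hmaps hQne (by
      rw [nsmul_eq_mul]
      calc (Q.card : ℝ) * (α * β / 4 * N) ≤ 2 * N' * (α * β / 4 * N) := by gcongr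
        _ = (α / 2 * N') * (β * N) := by ring
        _ ≤ _ := hprod)
  set P := (T' ×ˢ S).filter fun p ↦ p.1 - p.2 = t with hP
  have hPmem : ∀ p ∈ P, p.1 ∈ T' ∧ p.2 ∈ S ∧ p.1 = p.2 + t ∧ L ≤ t := by
    intro p hp
    obtain ⟨hp, hpt⟩ := Finset.mem_filter.1 hp
    obtain ⟨hx, hy⟩ := Finset.mem_product.1 hp
    have h1 := hT'mem _ hx
    have h2 := hSmem _ hy
    exact ⟨hx, hy, by omega, by omega⟩
  have hcard : (P.image Prod.snd).card = P.card := by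
    refine Finset.card_image_of_injOn fun p hp q hq hpq ↦ ?_
    have h1 := (hPmem p hp).2.2.1
    have h2 := (hPmem q hq).2.2.1
    exact Prod.ext (by rw [h1, h2, hpq]) hpq
  have hPpos : 0 < P.card := by
    have : (0 : ℝ) < P.card := lt_of_lt_of_le (by positivity) ht
    exact_mod_cast this
  obtain ⟨p₀, hp₀⟩ := Finset.card_pos.1 hPpos
  refine ⟨N, hN, M, t, (hPmem p₀ hp₀).2.2.2, P.image Prod.snd, ?_, ?_, by rw [hcard]; exact ht⟩
  · intro y hy
    obtain ⟨p, hp, rfl⟩ := Finset.mem_image.1 hy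
    exact hS (hPmem p hp).2.1
  · intro y hy
    obtain ⟨p, hp, rfl⟩ := Finset.mem_image.1 hy
    obtain ⟨h1, h2, h3, -⟩ := hPmem p hp
    exact ⟨hSB _ h2, h3 ▸ (hT'mem _ h1).1⟩

/-- For a sequence of subsets of longer and longer intervals, of density bounded below, finitely
many shifts suffice to meet every shift for almost all indices of an ultrafilter. -/
theorem exists_finset_eventually_inter_shift {δ : ℝ} (hδ : 0 < δ) {N M : ℕ → ℕ}
    {C : ℕ → Finset ℕ} (hN : ∀ L, L ≤ N L) (hC : ∀ L, C L ⊆ Finset.Ioc (M L) (M L + N L))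
    (hcard : ∀ L, δ * N L ≤ (C L).card) (U : Ultrafilter ℕ) (hU : ↑U ≤ (atTop : Filter ℕ)) :
    ∃ F : Finset ℕ, ∀ w : ℕ, ∃ f ∈ F, ∀ᶠ L in U, ∃ c ∈ C L, ∃ c' ∈ C L, c + w = c' + f := by
  by_contra! hcon
  obtain ⟨g, -, hg⟩ := exists_seq_of_forall_finset_exists (fun _ : ℕ ↦ True)
    (fun f w ↦ ¬ ∀ᶠ L in U, ∃ c ∈ C L, ∃ c' ∈ C L, c + w = c' + f) (fun F _ ↦ by
      obtain ⟨w, hw⟩ := hcon F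
      refine ⟨w, trivial, fun f hf h ↦ ?_⟩
      obtain ⟨L, h1, h2⟩ := (Filter.Eventually.and (hw f hf) h).exists
      obtain ⟨c, hc, c', hc', he⟩ := h2
      exact h1 c hc c' hc' he)
  set K := ⌈2 / δ⌉₊
  have hK : 2 ≤ K * δ := (div_le_iff₀ hδ).1 (Nat.le_ceil _)
  set G := (Finset.range K).sup g
  have hdisj : ∀ᶠ L in U, ∀ i ∈ Finset.range K, ∀ j ∈ Finset.range K, i < j →
      ¬ ∃ c ∈ C L, ∃ c' ∈ C L, c + g j = c' + g i := by
    simp only [Finset.eventually_all, eventually_imp_distrib_left]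
    exact fun i _ j _ hij ↦ Ultrafilter.eventually_not.2 (hg i j hij)
  obtain ⟨L, hL, hLG⟩ := (hdisj.and (hU (eventually_gt_atTop G))).exists
  have hle : (Finset.range K ×ˢ C L).card ≤ (Finset.Ioc (M L) (M L + N L + G)).card := by
    refine Finset.card_le_card_of_injOn (fun p ↦ p.2 + g p.1) ?_ ?_
    · rintro ⟨i, c⟩ hp
      obtain ⟨hi, hc⟩ := Finset.mem_product.1 hp
      have h1 := Finset.mem_Ioc.1 (hC L hc)
      have h2 : g i ≤ G := Finset.le_sup (f := g) hi
      simp only [Finset.coe_Ioc, Set.mem_Ioc] at h1 ⊢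
      omega
    · rintro ⟨i, c⟩ hp ⟨j, c'⟩ hq he
      obtain ⟨hi, hc⟩ := Finset.mem_product.1 hp
      obtain ⟨hj, hc'⟩ := Finset.mem_product.1 hq
      dsimp only at he hi hc hj hc'
      rcases lt_trichotomy i j with h | rfl | h
      · exact (hL i hi j hj h ⟨c', hc', c, hc, he.symm⟩).elim
      · rw [Nat.add_right_cancel he]
      · exact (hL j hj i hi h ⟨c, hc, c', hc', he⟩).elim
  rw [Finset.card_product, Finset.card_range, Nat.card_Ioc] at hle
  have hle' : (K : ℝ) * (C L).card ≤ N L + G := by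
    have : K * (C L).card ≤ N L + G := by omega
    exact_mod_cast this
  have h1 : (2 : ℝ) * N L ≤ K * (C L).card := by
    calc (2 : ℝ) * N L ≤ K * δ * N L := by gcongr
      _ = K * (δ * N L) := by ring
      _ ≤ _ := by gcongr; exact hcard L
  have h2 : (G : ℝ) < N L := by exact_mod_cast lt_of_lt_of_le hLG (hN L)
  linarith

/-- Jin's theorem: if `A` and `B` have positive upper Banach density, then the difference
set `A - B = {a - b : a ∈ A, b ∈ B, a ≥ b}` is piecewise syndetic. -/
theorem jin (A B : Set ℕ) (hA : 0 < upperBanachDensity A) (hB : 0 < upperBanachDensity B) :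
    PiecewiseSyndetic {d : ℕ | ∃ a ∈ A, ∃ b ∈ B, b ≤ a ∧ d = a - b} := by
  obtain ⟨δ, hδ, h⟩ := exists_common_dense_subset hA hB
  choose N hN M t ht C hC hCAB hcard using h
  have hU : ↑(hyperfilter ℕ) ≤ (atTop : Filter ℕ) := Nat.hyperfilter_le_atTop
  obtain ⟨F, hF⟩ := exists_finset_eventually_inter_shift hδ hN hC hcard (hyperfilter ℕ) hU
  choose f hfF hf using hF
  set G := F.sup id
  refine PiecewiseSyndetic.of_shifts (F.image (G - ·)) fun k ↦ ?_
  have hev : ∀ᶠ L in hyperfilter ℕ, ∀ w ∈ Finset.range (k + 1),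
      ∃ c ∈ C L, ∃ c' ∈ C L, c + w = c' + f w :=
    (Finset.eventually_all _).2 fun w _ ↦ hf w
  obtain ⟨L, hL, hLG⟩ := (hev.and (hU (eventually_ge_atTop G))).exists
  have htG : G ≤ t L := hLG.trans (ht L)
  refine ⟨t L - G, fun m hm ↦ ?_⟩
  rw [Set.mem_Icc] at hm
  obtain ⟨c, hc, c', hc', he⟩ := hL (m - (t L - G)) (Finset.mem_range.2 (by omega))
  set w := m - (t L - G) with hw
  have hfG : f w ≤ G := Finset.le_sup (f := id) (hfF w)
  refine ⟨G - f w, Finset.mem_image_of_mem _ (hfF w), c' + t L, (hCAB L c' hc').2, c,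
    (hCAB L c hc).1, ?_, ?_⟩ <;> omega
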